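/- Let μ = (μ₁,…,μ_s) be a partition of n with 2 ≤ i < j ≤ s, μ_{i-1} > μ_i, and (j = s or μ_j > μ_{j+1}). Let μ(i,j) denote μ with the i-th part increased by 1 and the j-th part decreased by 1 (deleting a resulting zero part). Then f(μ(i,j)) ≥ f(μ), with equality if and only if μ₁ = 3, all parts μ₂,…,μ_{i-1} equal 2, and μ_i = μ_{i+1} = ⋯ = μ_s = 1. -/

import Mathlib

/-- The odd double factorial `(2k-1)!! = 1 * 3 * ... * (2k-1)`, with `odf 0 = 1`. -/
def odf (k : Nat) : Int := ∏ j ∈ Finset.Icc 1 k, (2 * (j : Int) - 1)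

/-- Subtract `k` from every part, deleting parts that become zero. -/
def subHat (k : Nat) (l : List Nat) : List Nat :=
  (l.map (fun x => x - k)).filter (fun x => x ≠ 0)

/-- `l` is a partition: a non-increasing list of positive integers. -/
def IsPartition (l : List Nat) : Prop := l.Chain' (· ≥ ·) ∧ ∀ x ∈ l, 0 < x

/-- Increase the `i`-th part (1-based indexing). -/
def upAt (i : Nat) (l : List Nat) : List Nat := l.set (i - 1) (l.getD (i - 1) 0 + 1)

/-- Decrease the `j`-th part (1-based indexing), deleting it if it becomes zero. -/
def downAt (j : Nat) (l : List Nat) : List Nat :=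
  (l.set (j - 1) (l.getD (j - 1) 0 - 1)).filter (fun x => x ≠ 0)

open MvPolynomial Finset

lemma odf_zero : odf 0 = 1 := by simp [odf]

lemma odf_succ (k : ℕ) : odf (k + 1) = odf k * (2 * k + 1) := by
  unfold odf
  rw [Finset.prod_Icc_succ_top (by omega)]
  push_cast
  ring

lemma odf_pos (k : ℕ) : 0 < odf k := by
  induction k with
  | zero => simp [odf_zero]
  | succ k ih => rw [odf_succ]; positivity

/-- The `k`-th moment of the `m`-th variable: `d k` for the variable `0`, and the moment
`(2k-1)!!` of a squared standard Gaussian for all other variables. -/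
def varMoment (d : ℕ → ℤ) (m k : ℕ) : ℤ := if m = 0 then d k else odf k

/-- The expectation functional on polynomials in independent variables whose moments are given
by `varMoment`. -/
noncomputable def moment (d : ℕ → ℤ) : MvPolynomial ℕ ℤ →ₗ[ℤ] ℤ :=
  (basisMonomials ℕ ℤ).constr ℤ fun α => α.prod (varMoment d)

/-- Polynomials with nonnegative coefficients. -/
def nonnegCoeff : Subsemiring (MvPolynomial ℕ ℤ) where
  carrier := {p | ∀ α, 0 ≤ p.coeff α}
  mul_mem' {p q} hp hq α := by
    rw [coeff_mul]
    exact Finset.sum_nonneg fun x _ => mul_nonneg (hp _) (hq _)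
  one_mem' α := by rw [coeff_one]; split_ifs <;> simp
  add_mem' {p q} hp hq α := by rw [coeff_add]; exact add_nonneg (hp α) (hq α)
  zero_mem' α := by simp

lemma X_mem_nonnegCoeff (m : ℕ) : (X m : MvPolynomial ℕ ℤ) ∈ nonnegCoeff := by
  intro α
  rw [coeff_X]
  split_ifs <;> simp

/-- The sum of the first `h` variables. -/
noncomputable def colSum (h : ℕ) : MvPolynomial ℕ ℤ := ∑ m ∈ range h, X m

/-- The product of `colSum` over columns, where `e m` columns have height `m + 1`. -/
noncomputable def colProd (N : ℕ) (e : ℕ → ℕ) : MvPolynomial ℕ ℤ :=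
  ∏ m ∈ range N, colSum (m + 1) ^ e m

lemma colSum_succ (h : ℕ) : colSum (h + 1) = colSum h + X h := by
  simp [colSum, sum_range_succ]

lemma colProd_succ (N : ℕ) (e : ℕ → ℕ) :
    colProd (N + 1) e = colProd N e * colSum (N + 1) ^ e N := by
  simp [colProd, prod_range_succ]

lemma colSum_mem_nonnegCoeff (h : ℕ) : colSum h ∈ nonnegCoeff :=
  sum_mem fun m _ => X_mem_nonnegCoeff m

lemma colProd_mem_nonnegCoeff (N : ℕ) (e : ℕ → ℕ) : colProd N e ∈ nonnegCoeff :=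
  prod_mem fun _ _ => pow_mem (colSum_mem_nonnegCoeff _) _

lemma colProd_add_single {N a : ℕ} (ha : a < N) (e : ℕ → ℕ) :
    colProd N (e + Pi.single a 1) = colProd N e * colSum (a + 1) := by
  simp only [colProd, Pi.add_apply, pow_add, prod_mul_distrib]
  congr 1
  rw [prod_eq_single_of_mem a (by simpa using ha)]
  · simp
  · intro b _ hb
    simp [Pi.single_eq_of_ne hb]

section Moment

variable {d : ℕ → ℤ}

lemma moment_monomial (α : ℕ →₀ ℕ) (c : ℤ) :
    moment d (monomial α c) = c * α.prod (varMoment d) := by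
  have h : (monomial α c : MvPolynomial ℕ ℤ) = c • basisMonomials ℕ ℤ α := by
    simp [smul_monomial]
  rw [h, map_smul, moment, Module.Basis.constr_basis, smul_eq_mul]

lemma moment_mul_eq_sum (p q : MvPolynomial ℕ ℤ) :
    moment d (p * q) = ∑ α ∈ p.support, p.coeff α * moment d (monomial α 1 * q) := by
  conv_lhs => rw [p.as_sum, sum_mul, map_sum]
  refine sum_congr rfl fun α _ => ?_
  have h : (monomial α (p.coeff α) : MvPolynomial ℕ ℤ) = p.coeff α • monomial α 1 := by
    simp [smul_monomial]
  rw [h, smul_mul_assoc, map_smul, smul_eq_mul]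

lemma varMoment_zero (hd0 : d 0 = 1) (m : ℕ) : varMoment d m 0 = 1 := by
  unfold varMoment; split_ifs <;> simp [hd0, odf_zero]

lemma moment_monomial_add (hd0 : d 0 = 1) {i j : ℕ} (hij : i ≠ j) (α : ℕ →₀ ℕ) (k l : ℕ) :
    moment d (monomial α 1 * X i ^ k * X j ^ l) =
      ((α.erase i).erase j).prod (varMoment d) * varMoment d i (α i + k)
        * varMoment d j (α j + l) := by
  rw [X_pow_eq_monomial, X_pow_eq_monomial, monomial_mul, monomial_mul, moment_monomial,
    ← Finsupp.mul_prod_erase' _ i _ (varMoment_zero hd0),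
    ← Finsupp.mul_prod_erase' _ j _ (varMoment_zero hd0)]
  have h : ((α + Finsupp.single i k + Finsupp.single j l).erase i).erase j
      = (α.erase i).erase j := by
    ext m
    by_cases h1 : m = j
    · simp [h1]
    · by_cases h2 : m = i
      · simp [h2, hij]
      · simp [h1, h2, Finsupp.erase_ne, Finsupp.single_eq_of_ne]
  rw [h]
  simp [hij, hij.symm, Finsupp.erase_ne, Finsupp.single_eq_of_ne]
  ring

lemma moment_mul_X_pow (hd0 : d 0 = 1) {i : ℕ} (hi : i ≠ 0) (k : ℕ) {p : MvPolynomial ℕ ℤ}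
    (hp : i ∉ p.vars) : moment d (p * X i ^ k) = odf k * moment d p := by
  have h := moment_mul_eq_sum (d := d) p 1
  rw [mul_one] at h
  rw [moment_mul_eq_sum, h, mul_sum]
  refine sum_congr rfl fun α hα => ?_
  have hαi : α i = 0 := by
    by_contra h0
    exact hp ((mem_vars_iff_mem_support i).2 ⟨α, hα, by simpa using h0⟩)
  have h1 := moment_monomial_add hd0 (Nat.succ_ne_self i).symm α k 0
  have h2 := moment_monomial_add hd0 (Nat.succ_ne_self i).symm α 0 0
  simp only [pow_zero, mul_one, hαi, varMoment_zero hd0] at h1 h2 ⊢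
  rw [h1, h2]
  simp [varMoment, hi]
  ring

lemma moment_X_zero_pow (hd0 : d 0 = 1) (k : ℕ) : moment d (X 0 ^ k) = d k := by
  rw [X_pow_eq_monomial, moment_monomial, Finsupp.prod_single_index (varMoment_zero hd0 0)]
  simp [varMoment]

lemma varMoment_nonneg (hd : ∀ n, 0 ≤ d n) (m k : ℕ) : 0 ≤ varMoment d m k := by
  unfold varMoment
  split_ifs
  exacts [hd k, (odf_pos k).le]

lemma moment_nonneg (hd : ∀ n, 0 ≤ d n) {p : MvPolynomial ℕ ℤ} (hp : p ∈ nonnegCoeff) :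
    0 ≤ moment d p := by
  rw [← mul_one p, moment_mul_eq_sum]
  refine sum_nonneg fun α _ => mul_nonneg (hp α) ?_
  rw [mul_one, moment_monomial, one_mul]
  exact prod_nonneg fun m _ => varMoment_nonneg hd _ _

lemma moment_pos (hd : ∀ n, 0 ≤ d n) (hd' : ∀ n, n ≠ 1 → 0 < d n) {p : MvPolynomial ℕ ℤ}
    (hp : p ∈ nonnegCoeff) {α : ℕ →₀ ℕ} (hα : 0 < p.coeff α) (hα0 : α 0 ≠ 1) :
    0 < moment d p := by
  rw [← mul_one p, moment_mul_eq_sum]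
  refine sum_pos' (fun β _ => mul_nonneg (hp β) ?_) ⟨α, mem_support_iff.2 hα.ne', mul_pos hα ?_⟩
  all_goals rw [mul_one, moment_monomial, one_mul]
  · exact prod_nonneg fun m _ => varMoment_nonneg hd _ _
  · refine prod_pos fun m _ => ?_
    unfold varMoment
    split_ifs with h
    · exact hd' _ (h ▸ hα0)
    · exact odf_pos _

lemma moment_mul_sub_sq_nonneg (hd0 : d 0 = 1) (hd : ∀ n, 0 ≤ d n) {i j : ℕ} (hi : i ≠ 0)
    (hj : j ≠ 0) (hij : i ≠ j) {p : MvPolynomial ℕ ℤ} (hp : p ∈ nonnegCoeff) :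
    0 ≤ moment d (p * (X i - X j) ^ 2) := by
  rw [moment_mul_eq_sum]
  refine sum_nonneg fun α _ => mul_nonneg (hp α) ?_
  have h : (monomial α 1 * (X i - X j) ^ 2 : MvPolynomial ℕ ℤ) =
      monomial α 1 * X i ^ 2 * X j ^ 0 - (2 : ℤ) • (monomial α 1 * X i ^ 1 * X j ^ 1)
        + monomial α 1 * X i ^ 0 * X j ^ 2 := by
    rw [zsmul_eq_mul]
    push_cast
    ring
  rw [h, map_add, map_sub, map_smul]
  simp only [moment_monomial_add hd0 hij]
  set c := ((α.erase i).erase j).prod (varMoment d)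
  have hc : 0 ≤ c := prod_nonneg fun m _ => varMoment_nonneg hd _ _
  simp only [varMoment, hi, hj, if_false, odf_succ, add_zero, smul_eq_mul]
  have h1 := odf_pos (α i)
  have h2 := odf_pos (α j)
  generalize odf (α i) = a at *
  generalize odf (α j) = b at *
  push_cast
  generalize hu : (α i : ℤ) = u
  generalize hv : (α j : ℤ) = v
  have hu0 : 0 ≤ u := by omega
  have hv0 : 0 ≤ v := by omega
  have key : 0 ≤ c * a * b * ((2 * u - 2 * v) ^ 2 + 4 * u + 4 * v + 4) := by positivity
  linarith

lemma moment_rename_swap {i j : ℕ} (hi : i ≠ 0) (hj : j ≠ 0) (p : MvPolynomial ℕ ℤ) :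
    moment d (rename (Equiv.swap i j) p) = moment d p := by
  induction p using MvPolynomial.induction_on' with
  | monomial α c =>
    rw [rename_monomial, moment_monomial, moment_monomial,
      Finsupp.prod_mapDomain_index_inj (Equiv.injective _)]
    congr 1
    refine Finsupp.prod_congr fun m _ => ?_
    have h : Equiv.swap i j m = 0 ↔ m = 0 := by
      rw [Equiv.swap_apply_eq_iff, Equiv.swap_apply_of_ne_of_ne hi.symm hj.symm]
    simp [varMoment, h]
  | add p q hp hq => rw [map_add, map_add, map_add, hp, hq]

end Moment

lemma rename_mem_nonnegCoeff (σ : Equiv.Perm ℕ) {p : MvPolynomial ℕ ℤ} (hp : p ∈ nonnegCoeff) :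
    rename σ p ∈ nonnegCoeff := by
  intro α
  obtain ⟨β, rfl⟩ := Finsupp.mapDomain_surjective (M := ℕ) σ.surjective α
  rw [coeff_rename_mapDomain _ σ.injective]
  exact hp β

lemma rename_swap_colSum {i j : ℕ} (hij : i < j) (h : ℕ) :
    rename (Equiv.swap i j) (colSum h) =
      colSum h - if i < h ∧ h ≤ j then X i - X j else 0 := by
  have key (m : ℕ) : rename (Equiv.swap i j) (X m : MvPolynomial ℕ ℤ) =
      X m - ((if i = m then X i - X j else 0) - if j = m then X i - X j else 0) := by
    rw [rename_X]
    obtain rfl | h1 := eq_or_ne i m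
    · simp [hij.ne']
    · obtain rfl | h2 := eq_or_ne j m
      · simp [h1]
      · simp [h1, h2, Equiv.swap_apply_of_ne_of_ne h1.symm h2.symm]
  rw [colSum, map_sum]
  simp only [key, sum_sub_distrib, sum_ite_eq, mem_range]
  split_ifs <;> first | omega | simp

/-- Polynomials `p` with nonnegative coefficients whose difference with the image of `p` under
swapping two variables is the difference of these variables times a polynomial with nonnegative
coefficients. -/
def swapMonotone (i j : ℕ) : Submonoid (MvPolynomial ℕ ℤ) where
  carrier := {p | p ∈ nonnegCoeff ∧
    ∃ q ∈ nonnegCoeff, p - rename (Equiv.swap i j) p = (X i - X j) * q}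
  one_mem' := ⟨one_mem _, 0, zero_mem _, by simp⟩
  mul_mem' := by
    rintro p p' ⟨hp, q, hq, h⟩ ⟨hp', q', hq', h'⟩
    refine ⟨mul_mem hp hp', q * p' + rename (Equiv.swap i j) p * q',
      add_mem (mul_mem hq hp') (mul_mem (rename_mem_nonnegCoeff _ hp) hq'), ?_⟩
    rw [map_mul]
    linear_combination p' * h + rename (Equiv.swap i j) p * h'

lemma colSum_mem_swapMonotone {i j : ℕ} (hij : i < j) (h : ℕ) : colSum h ∈ swapMonotone i j := by
  refine ⟨colSum_mem_nonnegCoeff h, if i < h ∧ h ≤ j then 1 else 0, ?_, ?_⟩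
  · split_ifs
    exacts [one_mem _, zero_mem _]
  · rw [rename_swap_colSum hij]
    split_ifs <;> simp

lemma colProd_mem_swapMonotone {i j : ℕ} (hij : i < j) (N : ℕ) (e : ℕ → ℕ) :
    colProd N e ∈ swapMonotone i j :=
  prod_mem fun _ _ => pow_mem (colSum_mem_swapMonotone hij _) _

/-- The polynomial has a monomial with positive coefficient whose exponent of the variable `0`
is `k`. -/
def HasPosTerm (p : MvPolynomial ℕ ℤ) (k : ℕ) : Prop := ∃ α, 0 < p.coeff α ∧ α 0 = k

lemma HasPosTerm.mul {p q : MvPolynomial ℕ ℤ} {k l : ℕ} (hp : HasPosTerm p k)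
    (hq : HasPosTerm q l) (hp' : p ∈ nonnegCoeff) (hq' : q ∈ nonnegCoeff) :
    HasPosTerm (p * q) (k + l) := by
  obtain ⟨α, hα, rfl⟩ := hp
  obtain ⟨β, hβ, rfl⟩ := hq
  refine ⟨α + β, ?_, rfl⟩
  rw [coeff_mul]
  exact sum_pos' (fun x _ => mul_nonneg (hp' _) (hq' _))
    ⟨(α, β), mem_antidiagonal.2 rfl, mul_pos hα hβ⟩

lemma HasPosTerm.pow {p : MvPolynomial ℕ ℤ} {k : ℕ} (hp : HasPosTerm p k)
    (hp' : p ∈ nonnegCoeff) (n : ℕ) : HasPosTerm (p ^ n) (n * k) := by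
  induction n with
  | zero => exact ⟨0, by simp⟩
  | succ n ih =>
    rw [pow_succ, Nat.succ_mul]
    exact ih.mul hp (pow_mem hp' n) hp'

lemma hasPosTerm_sum_X {s : Finset ℕ} {a : ℕ} (ha : a ∈ s) :
    HasPosTerm (∑ m ∈ s, X m) (if a = 0 then 1 else 0) := by
  refine ⟨Finsupp.single a 1, ?_, by simp [Finsupp.single_apply]⟩
  rw [coeff_sum]
  refine sum_pos' (fun m _ => X_mem_nonnegCoeff m _) ⟨a, ha, by simp⟩

lemma hasPosTerm_colProd (N : ℕ) (e : ℕ → ℕ) : HasPosTerm (colProd (N + 1) e) (e 0) := by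
  induction N with
  | zero =>
    have h := (hasPosTerm_sum_X (mem_range.2 one_pos)).pow (colSum_mem_nonnegCoeff 1) (e 0)
    simpa [colProd, colSum] using h
  | succ N ih =>
    rw [colProd_succ]
    have h := (hasPosTerm_sum_X (mem_range.2 (show 1 < N + 1 + 1 by omega))).pow
      (colSum_mem_nonnegCoeff _) (e (N + 1))
    simpa [colSum] using ih.mul h (colProd_mem_nonnegCoeff _ _)
      (pow_mem (colSum_mem_nonnegCoeff _) _)

lemma exists_hasPosTerm_colProd {N : ℕ} {e : ℕ → ℕ}
    (he : ¬ ∀ m < N + 1, e m = Pi.single (M := fun _ => ℕ) 0 1 m) :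
    ∃ k ≠ 1, HasPosTerm (colProd (N + 1) e) k := by
  by_cases h0 : e 0 = 1
  · push Not at he
    obtain ⟨m, hm, hem⟩ := he
    have hm0 : m ≠ 0 := by
      rintro rfl
      simp [h0] at hem
    rw [Pi.single_eq_of_ne hm0] at hem
    obtain ⟨e', rfl⟩ : ∃ e', e = e' + Pi.single m 1 :=
      ⟨e - Pi.single m 1, (tsub_add_cancel_of_le (by
        intro x
        obtain rfl | hx := eq_or_ne x m
        · simp; omega
        · simp [hx])).symm⟩
    have he' : e' 0 = 1 := by simpa [hm0.symm] using h0
    refine ⟨1 + 1, by norm_num, ?_⟩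
    rw [colProd_add_single hm, ← he']
    have h := (hasPosTerm_sum_X (mem_range.2 (Nat.succ_pos m)))
    rw [if_pos rfl] at h
    simpa [he', colSum] using
      (hasPosTerm_colProd N e').mul h (colProd_mem_nonnegCoeff _ _) (colSum_mem_nonnegCoeff _)
  · exact ⟨e 0, h0, hasPosTerm_colProd N e⟩

lemma moment_colProd_swap_nonneg {d : ℕ → ℤ} (hd0 : d 0 = 1) (hd : ∀ n, 0 ≤ d n) {p q : ℕ}
    (hp : p ≠ 0) (hpq : p < q) (N : ℕ) (r : ℕ → ℕ) :
    0 ≤ moment d (colProd N r * (X p - X q) * colSum p) := by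
  obtain ⟨hR, Q, hQ, h⟩ := colProd_mem_swapMonotone hpq N r
  have h1 := moment_rename_swap (d := d) hp (by omega : q ≠ 0)
    (colProd N r * (X p - X q) * colSum p)
  have h2 : rename (Equiv.swap p q) (colSum p) = colSum p := by
    rw [rename_swap_colSum hpq]; simp
  have h3 := moment_mul_sub_sq_nonneg hd0 hd hp (by omega : q ≠ 0) hpq.ne
    (mul_mem hQ (colSum_mem_nonnegCoeff p))
  have h4 : Q * colSum p * (X p - X q) ^ 2 = colProd N r * (X p - X q) * colSum p
      + rename (Equiv.swap p q) (colProd N r * (X p - X q) * colSum p) := by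
    rw [map_mul, map_mul, map_sub, rename_X, rename_X, h2, Equiv.swap_apply_left,
      Equiv.swap_apply_right]
    linear_combination (- (X p - X q) * colSum p) * h
  rw [h4, map_add, h1] at h3
  linarith

lemma colSum_eq_add {p q : ℕ} (hpq : p ≤ q) : colSum q = colSum p + ∑ m ∈ Ico p q, X m :=
  (sum_range_add_sum_Ico _ hpq).symm

lemma moment_X_zero_mul (d : ℕ → ℤ) (hd0 : d 0 = 1) (hd1 : d 1 = 0) {p m : ℕ} (hp : p ≠ 0)
    (hm : m ≠ 0) : moment d (X 0 * X p * X m) = 0 := by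
  simp only [X, monomial_mul, moment_monomial]
  rw [← Finsupp.mul_prod_erase' _ 0 _ (varMoment_zero hd0)]
  simp [hp.symm, hm.symm, Finsupp.single_eq_of_ne, varMoment, hd1]

theorem moment_colProd_le {d : ℕ → ℤ} (hd0 : d 0 = 1) (hd1 : d 1 = 0) (hd : ∀ n, n ≠ 1 → 0 < d n)
    {a b N : ℕ} (hab : a < b) (hbN : b + 1 < N) (r : ℕ → ℕ) :
    moment d (colProd N (r + Pi.single a 1 + Pi.single (b + 1) 1)) ≤
        moment d (colProd N (r + Pi.single (a + 1) 1 + Pi.single b 1)) ∧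
      (moment d (colProd N (r + Pi.single (a + 1) 1 + Pi.single b 1)) =
          moment d (colProd N (r + Pi.single a 1 + Pi.single (b + 1) 1)) ↔
        ∀ m < N, r m = Pi.single (M := fun _ => ℕ) 0 1 m) := by
  have hd' (n : ℕ) : 0 ≤ d n := by
    obtain rfl | h := eq_or_ne n 1
    exacts [hd1.ge, (hd n h).le]
  rw [colProd_add_single (by omega), colProd_add_single (by omega), colProd_add_single (by omega),
    colProd_add_single (by omega)]
  have hdiff : moment d (colProd N r * colSum (a + 1 + 1) * colSum (b + 1)) =
      moment d (colProd N r * colSum (a + 1) * colSum (b + 1 + 1))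
        + moment d (colProd N r * (X (a + 1) - X (b + 1)) * colSum (a + 1))
        + moment d (colProd N r * X (a + 1) * ∑ m ∈ Ico (a + 1) (b + 1), X m) := by
    rw [← map_add, ← map_add]
    congr 1
    rw [colSum_succ (a + 1), colSum_succ (b + 1), colSum_eq_add (show a + 1 ≤ b + 1 by omega)]
    ring
  have hA := moment_colProd_swap_nonneg hd0 hd' a.succ_ne_zero (show a + 1 < b + 1 by omega) N r
  have hmem1 := mul_mem (colProd_mem_nonnegCoeff N r) (X_mem_nonnegCoeff (a + 1))
  have hmem2 : ∑ m ∈ Ico (a + 1) (b + 1), (X m : MvPolynomial ℕ ℤ) ∈ nonnegCoeff :=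
    sum_mem fun m _ => X_mem_nonnegCoeff m
  have hB := moment_nonneg hd' (mul_mem hmem1 hmem2)
  refine ⟨by linarith, fun heq => ?_, fun hr => ?_⟩
  · by_contra hr
    obtain ⟨N, rfl⟩ : ∃ M, N = M + 1 := ⟨N - 1, by omega⟩
    obtain ⟨k, hk, hpos⟩ := exists_hasPosTerm_colProd hr
    have h1 := hasPosTerm_sum_X (mem_singleton_self (a + 1))
    rw [sum_singleton] at h1
    have h2 := hasPosTerm_sum_X (left_mem_Ico.2 (show a + 1 < b + 1 by omega))
    obtain ⟨α, hα, hα0⟩ := (hpos.mul h1 (colProd_mem_nonnegCoeff _ r)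
      (X_mem_nonnegCoeff _)).mul h2 hmem1 hmem2
    have := moment_pos hd' hd (mul_mem hmem1 hmem2) hα (by simpa [hα0] using hk)
    linarith
  · have hR : colProd N r = X 0 := by
      rw [colProd, prod_eq_single_of_mem 0 (mem_range.2 (by omega))]
      · simp [hr 0 (by omega), colSum]
      · intro m hm hm0
        rw [hr m (mem_range.1 hm), Pi.single_eq_of_ne hm0, pow_zero]
    rw [hdiff, hR, mul_sum, map_sum, sum_eq_zero fun m hm =>
      moment_X_zero_mul d hd0 hd1 a.succ_ne_zero (by rw [mem_Ico] at hm; omega)]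
    have h1 := moment_rename_swap (d := d) a.succ_ne_zero b.succ_ne_zero
      (X 0 * (X (a + 1) - X (b + 1)) * colSum (a + 1))
    have h2 : rename (Equiv.swap (a + 1) (b + 1)) (colSum (a + 1)) = colSum (a + 1) := by
      rw [rename_swap_colSum (by omega)]; simp
    have h3 : rename (Equiv.swap (a + 1) (b + 1))
        (X 0 * (X (a + 1) - X (b + 1)) * colSum (a + 1)) =
          -(X 0 * (X (a + 1) - X (b + 1)) * colSum (a + 1)) := by
      rw [map_mul, map_mul, map_sub, rename_X, rename_X, rename_X, h2, Equiv.swap_apply_left,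
        Equiv.swap_apply_right, Equiv.swap_apply_of_ne_of_ne (by omega) (by omega)]
      ring
    rw [h3, map_neg] at h1
    linarith

/-- The number of columns of height `m + 1` of a partition. -/
def colCount (l : List ℕ) (m : ℕ) : ℕ := l.getD m 0 - l.getD (m + 1) 0

lemma isPartition_iff {l : List ℕ} :
    IsPartition l ↔ l.Pairwise (· ≥ ·) ∧ ∀ x ∈ l, 0 < x := by
  unfold IsPartition
  rw [List.Chain', List.isChain_iff_pairwise]

lemma getD_antitone_of_pairwise {l : List ℕ} (h : l.Pairwise (· ≥ ·)) :
    Antitone fun m => l.getD m 0 := by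
  refine antitone_nat_of_succ_le fun m => ?_
  by_cases hm : m + 1 < l.length
  · rw [List.getD_eq_getElem _ _ hm, List.getD_eq_getElem _ _ (by omega)]
    exact List.pairwise_iff_getElem.1 h m (m + 1) (by omega) hm (by omega)
  · rw [List.getD_eq_default _ _ (by omega)]
    exact Nat.zero_le _

lemma pairwise_of_getD_antitone {l : List ℕ} (h : Antitone fun m => l.getD m 0) :
    l.Pairwise (· ≥ ·) := by
  rw [List.pairwise_iff_getElem]
  intro i j hi hj hij
  have := h hij.le
  simp only at this
  rwa [List.getD_eq_getElem _ _ hi, List.getD_eq_getElem _ _ hj] at this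

lemma getD_filter_ne_zero {l : List ℕ} (h : l.Pairwise (· ≥ ·)) (m : ℕ) :
    (l.filter (fun x => x ≠ 0)).getD m 0 = l.getD m 0 := by
  induction l generalizing m with
  | nil => rfl
  | cons a t ih =>
    rw [List.pairwise_cons] at h
    by_cases ha : a = 0
    · subst ha
      have h0 : ∀ x ∈ 0 :: t, x = 0 := by
        intro x hx
        obtain rfl | hx := List.mem_cons.1 hx
        exacts [rfl, Nat.le_zero.1 (h.1 x hx)]
      have h1 : (0 :: t).filter (fun x => x ≠ 0) = [] := by
        rw [List.filter_eq_nil_iff]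
        intro x hx
        simp [h0 x hx]
      rw [h1]
      by_cases hm : m < (0 :: t).length
      · rw [List.getD_eq_getElem _ _ hm, h0 _ (List.getElem_mem hm)]
        rfl
      · rw [List.getD_eq_default _ _ (not_lt.1 hm)]
        rfl
    · rw [List.filter_cons_of_pos (by simpa using ha)]
      cases m with
      | zero => rfl
      | succ m => simpa using ih h.2 m

lemma isPartition_filter_ne_zero {l : List ℕ} (h : l.Pairwise (· ≥ ·)) :
    IsPartition (l.filter (fun x => x ≠ 0)) := by
  refine isPartition_iff.2 ⟨h.filter _, fun x hx => ?_⟩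
  have := (List.mem_filter.1 hx).2
  simp only [decide_eq_true_eq] at this
  omega

lemma pairwise_map_sub {l : List ℕ} (h : l.Pairwise (· ≥ ·)) (k : ℕ) :
    (l.map (fun x => x - k)).Pairwise (· ≥ ·) :=
  h.map _ fun _ _ hab => Nat.sub_le_sub_right hab k

lemma getD_subHat {l : List ℕ} (h : l.Pairwise (· ≥ ·)) (k m : ℕ) :
    (subHat k l).getD m 0 = l.getD m 0 - k := by
  rw [subHat, getD_filter_ne_zero (pairwise_map_sub h k),
    ← List.getD_map (f := fun x => x - k), Nat.zero_sub]

lemma length_subHat_le (k : ℕ) (l : List ℕ) : (subHat k l).length ≤ l.length :=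
  (List.length_filter_le _ _).trans (by simp)

lemma getD_dropLast (l : List ℕ) (m : ℕ) :
    l.dropLast.getD m 0 = if m + 1 < l.length then l.getD m 0 else 0 := by
  split_ifs with h
  · rw [List.getD_eq_getElem _ _ (by rw [List.length_dropLast]; omega),
      List.getD_eq_getElem _ _ (by omega), List.getElem_dropLast]
  · rw [List.getD_eq_default _ _ (by rw [List.length_dropLast]; omega)]

lemma getD_set {l : List ℕ} {n : ℕ} (hn : n < l.length) (v m : ℕ) :
    (l.set n v).getD m 0 = if m = n then v else l.getD m 0 := by
  obtain rfl | h := eq_or_ne m n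
  · simp [hn]
  · simp [h, h.symm]

lemma colProd_congr {N : ℕ} {e e' : ℕ → ℕ} (h : ∀ m < N, e m = e' m) :
    colProd N e = colProd N e' :=
  prod_congr rfl fun m hm => by rw [h m (mem_range.1 hm)]

lemma notMem_vars_colSum_pow_mul {N m : ℕ} (h : m ≤ N) (s k : ℕ) (hs : s ≤ N) (e : ℕ → ℕ) :
    N ∉ (colProd s e * colSum m ^ k).vars := by
  have hX (h : ℕ) (hh : h ≤ N) : colSum h ∈ supported ℤ {x | x < N} :=
    sum_mem fun x hx => X_mem_supported.2 (by rw [mem_range] at hx; exact hx.trans_le hh)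
  have h1 : colProd s e * colSum m ^ k ∈ supported ℤ {x | x < N} :=
    mul_mem (prod_mem fun x hx => pow_mem (hX _ (by rw [mem_range] at hx; omega)) _)
      (pow_mem (hX m h) k)
  intro hN
  exact lt_irrefl N (mem_supported.1 h1 hN)

theorem eq_moment_colProd {d : ℕ → ℤ} (hd0 : d 0 = 1)
    {f : List ℕ → ℤ} (hf0 : f [] = 1) (hf1 : ∀ m : ℕ, f [m] = d m)
    (hfr : ∀ l : List ℕ, IsPartition l → 2 ≤ l.length →
      f l = f l.dropLast + ∑ k ∈ Finset.Icc 1 (l.getLastD 0),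
        ((l.getLastD 0).choose k : ℤ) * odf k * f (subHat k l.dropLast))
    {N : ℕ} {l : List ℕ} (hl : IsPartition l) (hN : l.length ≤ N) :
    f l = moment d (colProd N (colCount l)) := by
  induction N generalizing l with
  | zero =>
    obtain rfl := List.length_eq_zero_iff.1 (Nat.le_zero.1 hN)
    have := moment_X_zero_pow hd0 0
    simp_all [colProd]
  | succ N ih =>
    obtain hlt | hlen := hN.lt_or_eq
    · rw [ih hl (by omega), colProd_succ, colCount, List.getD_eq_default _ _ (by omega)]
      simp
    · obtain rfl | ⟨s, rfl⟩ : N = 0 ∨ ∃ s, N = s + 1 := by cases N <;> simp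
      · obtain ⟨c, rfl⟩ := List.length_eq_one_iff.1 hlen
        rw [hf1, ← moment_X_zero_pow hd0]
        simp [colProd, colSum, colCount]
      · have hpw := (isPartition_iff.1 hl).1
        have hanti := getD_antitone_of_pairwise hpw
        have hpd : l.dropLast.Pairwise (· ≥ ·) := hpw.sublist (List.dropLast_sublist l)
        have hdrop : IsPartition l.dropLast := isPartition_iff.2
          ⟨hpd, fun x hx => (isPartition_iff.1 hl).2 x (List.mem_of_mem_dropLast hx)⟩
        have hlast : l.getLastD 0 = l.getD (s + 1) 0 := by
          rw [List.getLastD_eq_getLast?, List.getLast?_eq_getElem?, hlen]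
          simp [List.getD]
        set c := l.getD (s + 1) 0 with hc
        have hsc : c ≤ l.getD s 0 := hanti (Nat.le_succ s)
        have hstep {l' : List ℕ} {k : ℕ} (hk : k ≤ c) (hl' : IsPartition l')
            (hlen' : l'.length ≤ s + 1) (hget : ∀ m, l'.getD m 0 = l.dropLast.getD m 0 - k) :
            f l' = moment d (colProd s (colCount l) * colSum (s + 1) ^ (l.getD s 0 - k)) := by
          rw [ih hl' hlen', colProd_succ]
          congr 2
          · refine colProd_congr fun m hm => ?_
            have := hanti (show m + 1 ≤ s + 1 by omega)
            simp only at this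
            simp only [colCount, hget, getD_dropLast, hlen]
            rw [if_pos (by omega), if_pos (by omega)]
            omega
          · simp only [colCount, hget, getD_dropLast, hlen]
            rw [if_pos (by omega), if_neg (by omega)]
            congr 1
            omega
        rw [hfr l hl (by omega), hlast]
        have h0 := hstep (Nat.zero_le c) hdrop (by simp [hlen]) (by simp)
        have hk (k : ℕ) (hk : k ∈ Icc 1 c) := hstep (mem_Icc.1 hk).2
          (isPartition_filter_ne_zero (pairwise_map_sub hpd k))
          ((length_subHat_le k _).trans (by simp [hlen])) (getD_subHat hpd k)
        have hcol : colProd (s + 1 + 1) (colCount l) = ∑ k ∈ range (c + 1),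
            (c.choose k : ℤ) • (colProd s (colCount l) * colSum (s + 1) ^ (l.getD s 0 - k)
              * X (s + 1) ^ k) := by
          rw [colProd_succ, colProd_succ]
          have h1 : colCount l (s + 1) = c := by
            rw [colCount, List.getD_eq_default (n := s + 1 + 1) _ _ (by omega), Nat.sub_zero]
          have h2 : colCount l s = l.getD s 0 - c := rfl
          rw [h1, h2, colSum_succ (s + 1), add_comm (colSum (s + 1)), add_pow, mul_sum]
          refine sum_congr rfl fun k hk => ?_
          have hkc : k ≤ c := by rw [mem_range] at hk; omega
          rw [show l.getD s 0 - k = (l.getD s 0 - c) + (c - k) by omega, pow_add, zsmul_eq_mul]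
          push_cast
          ring
        rw [hcol, map_sum, range_eq_Ico, sum_eq_sum_Ico_succ_bot (Nat.succ_pos c)]
        congr 1
        · simpa using h0
        · refine sum_congr rfl fun k hk' => ?_
          rw [map_smul, moment_mul_X_pow hd0 (Nat.succ_ne_zero s) _
            (notMem_vars_colSum_pow_mul le_rfl s _ (Nat.le_succ s) _), smul_eq_mul, mul_assoc]
          congr 2
          exact hk k hk'

lemma pos_of_recurrence {d : ℕ → ℤ} (hd0 : d 0 = 1) (hd1 : d 1 = 0)
    (hd : ∀ n : ℕ, 2 ≤ n → d n = 2 * ((n : ℤ) - 1) * (d (n - 1) + d (n - 2)))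
    (n : ℕ) (hn : n ≠ 1) : 0 < d n := by
  have key (n : ℕ) : 0 ≤ d (n + 1) ∧ 0 < d (n + 2) := by
    induction n with
    | zero => simp [hd 2 le_rfl, hd0, hd1]
    | succ n ih =>
      refine ⟨ih.2.le, ?_⟩
      rw [hd (n + 1 + 2) (by omega)]
      have h1 : n + 1 + 2 - 1 = n + 2 := by omega
      have h2 : n + 1 + 2 - 2 = n + 1 := by omega
      rw [h1, h2]
      have : 0 < d (n + 2) + d (n + 1) := by linarith
      refine mul_pos (mul_pos two_pos ?_) this
      push_cast
      linarith
  match n, hn with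
  | 0, _ => simp [hd0]
  | n + 2, _ => exact (key n).2

lemma colCount_eq_iff {g : ℕ → ℕ} (hg : Antitone g) {N : ℕ} (hN : ∀ m, N ≤ m → g m = 0) {a b : ℕ}
    (hab : a < b) (hbN : b + 1 < N) :
    (∀ m < N, g m - g (m + 1) =
        (if m = 0 then 1 else 0) + (if m = a then 1 else 0) + if m = b + 1 then 1 else 0) ↔
      ∀ m, g m = (if m ≤ 0 then 1 else 0) + (if m ≤ a then 1 else 0) +
        if m ≤ b + 1 then 1 else 0 := by
  constructor
  · intro h
    have key (k : ℕ) : ∀ m, N - k ≤ m → g m = (if m ≤ 0 then 1 else 0)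
        + (if m ≤ a then 1 else 0) + if m ≤ b + 1 then 1 else 0 := by
      induction k with
      | zero =>
        intro m hm
        rw [hN m (by omega), if_neg (by omega), if_neg (by omega), if_neg (by omega)]
      | succ k ih =>
        intro m hm
        by_cases hm' : N - k ≤ m
        · exact ih m hm'
        · have h1 := ih (m + 1) (by omega)
          have h2 := h m (by omega)
          have h3 := hg (Nat.le_succ m)
          simp only [Nat.succ_eq_add_one] at h3
          split_ifs at h1 h2 ⊢ <;> omega
    exact fun m => key N m (by omega)
  · intro h m _
    rw [h m, h (m + 1)]
    split_ifs <;> omega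

theorem stmt10
    (d : Nat → Int) (hd0 : d 0 = 1) (hd1 : d 1 = 0)
    (hd : ∀ n : Nat, 2 ≤ n → d n = 2 * ((n : Int) - 1) * (d (n - 1) + d (n - 2)))
    (f : List Nat → Int) (hf0 : f [] = 1) (hf1 : ∀ m : Nat, f [m] = d m)
    (hfr : ∀ l : List Nat, IsPartition l → 2 ≤ l.length →
      f l = f l.dropLast + ∑ k ∈ Finset.Icc 1 (l.getLastD 0),
        ((l.getLastD 0).choose k : Int) * odf k * f (subHat k l.dropLast))
    (μ : List Nat) (hμ : IsPartition μ)
    (i j : Nat) (hi2 : 2 ≤ i) (hij : i < j) (hjs : j ≤ μ.length)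
    (hlt : μ.getD (i - 1) 0 < μ.getD (i - 2) 0)
    (hj : j = μ.length ∨ μ.getD j 0 < μ.getD (j - 1) 0) :
    f μ ≤ f (downAt j (upAt i μ))
      ∧ (f (downAt j (upAt i μ)) = f μ ↔
        (μ.getD 0 0 = 3 ∧ (∀ t : Nat, 2 ≤ t → t + 1 ≤ i → μ.getD (t - 1) 0 = 2)
          ∧ (∀ t : Nat, i ≤ t → t ≤ μ.length → μ.getD (t - 1) 0 = 1))) := by
  obtain ⟨a, rfl⟩ : ∃ a, i = a + 2 := ⟨i - 2, by omega⟩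
  obtain ⟨b, rfl⟩ : ∃ b, j = b + 2 := ⟨j - 2, by omega⟩
  simp only [Nat.add_sub_cancel, show a + 2 - 1 = a + 1 by omega,
    show b + 2 - 1 = b + 1 by omega] at hlt hj
  have hab : a < b := by omega
  obtain ⟨hpw, hpos⟩ := isPartition_iff.1 hμ
  have hanti := getD_antitone_of_pairwise hpw
  have hgpos (m : ℕ) (hm : m < μ.length) : 0 < μ.getD m 0 := by
    rw [List.getD_eq_getElem _ _ hm]
    exact hpos _ (List.getElem_mem hm)
  have hgzero (m : ℕ) (hm : μ.length ≤ m) : μ.getD m 0 = 0 := List.getD_eq_default _ _ hm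
  obtain ⟨g, hg⟩ : ∃ g : ℕ → ℕ, ∀ m, μ.getD m 0 = g m := ⟨_, fun _ => rfl⟩
  simp only [hg] at hlt hj hanti hgpos hgzero ⊢
  have hlt' : g (b + 1 + 1) < g (b + 1) := by
    obtain h | h := hj
    · rw [hgzero (b + 1 + 1) h.ge]
      exact hgpos _ (by omega)
    · exact h
  have hcongr (m x : ℕ) : m = x → g m = g x ∧ g (m + 1) = g (x + 1) := by
    rintro rfl
    exact ⟨rfl, rfl⟩
  set ν := (upAt (a + 2) μ).set (b + 1) ((upAt (a + 2) μ).getD (b + 1) 0 - 1) with hν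
  have hget (m : ℕ) : ν.getD m 0 = if m = a + 1 then g m + 1 else
      if m = b + 1 then g m - 1 else g m := by
    rw [hν, getD_set (by rw [upAt, List.length_set]; omega), upAt,
      show a + 2 - 1 = a + 1 by omega, getD_set (by omega), getD_set (by omega), hg, hg, hg]
    have h2 := hcongr m (a + 1)
    have h3 := hcongr m (b + 1)
    split_ifs <;> omega
  have hνpw : ν.Pairwise (· ≥ ·) := by
    refine pairwise_of_getD_antitone (antitone_nat_of_succ_le fun m => ?_)
    have h1 : g (m + 1) ≤ g m := hanti (Nat.le_succ m)
    have h2 := hcongr m a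
    have h3 := hcongr m (b + 1)
    simp only [hget]
    split_ifs <;> omega
  have hν' : downAt (b + 2) (upAt (a + 2) μ) = ν.filter (fun x => x ≠ 0) := rfl
  rw [hν', eq_moment_colProd hd0 hf0 hf1 hfr hμ le_rfl,
    eq_moment_colProd hd0 hf0 hf1 hfr (isPartition_filter_ne_zero hνpw) (N := μ.length)
      ((List.length_filter_le _ _).trans (by simp [hν, upAt]))]
  set r : ℕ → ℕ := colCount μ - (Pi.single a 1 + Pi.single (b + 1) 1) with hr
  have hrm (m : ℕ) : colCount μ m =
      r m + ((if m = a then 1 else 0) + if m = b + 1 then 1 else 0) := by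
    have h1 : (if m = a then 1 else 0) + (if m = b + 1 then 1 else 0) ≤ colCount μ m := by
      have h2 := hcongr m a
      have h3 := hcongr m (b + 1)
      simp only [colCount, hg]
      split_ifs <;> omega
    simp only [hr, Pi.sub_apply, Pi.add_apply, Pi.single_apply]
    omega
  have hμr : colCount μ = r + Pi.single a 1 + Pi.single (b + 1) 1 := by
    ext m
    simp only [hrm m, Pi.add_apply, Pi.single_apply]
    omega
  have hνr : colCount (ν.filter (fun x => x ≠ 0)) =
      r + Pi.single (a + 1) 1 + Pi.single b 1 := by
    ext m
    have h1 := hrm m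
    have h2 : g (m + 1) ≤ g m := hanti (Nat.le_succ m)
    simp only [colCount, hg, getD_filter_ne_zero hνpw, hget, Pi.add_apply,
      Pi.single_apply] at h1 ⊢
    have h3 := hcongr m a
    have h4 := hcongr m (b + 1)
    have h5 := hcongr m b
    split_ifs at h1 ⊢ <;> omega
  rw [hμr, hνr]
  obtain ⟨hle, heq⟩ := moment_colProd_le hd0 hd1 (pos_of_recurrence hd0 hd1 hd) hab
    (show b + 1 < μ.length by omega) r
  refine ⟨hle, heq.trans ?_⟩
  have hcount : (∀ m < μ.length, r m = Pi.single (M := fun _ => ℕ) 0 1 m) ↔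
      ∀ m < μ.length, g m - g (m + 1) =
        (if m = 0 then 1 else 0) + (if m = a then 1 else 0) + if m = b + 1 then 1 else 0 := by
    refine forall₂_congr fun m _ => ?_
    have h1 := hrm m
    simp only [colCount, hg] at h1
    rw [Pi.single_apply, h1]
    omega
  rw [hcount, colCount_eq_iff hanti hgzero hab (by omega)]
  constructor
  · intro h
    refine ⟨(h 0).trans (by simp), fun t ht1 ht2 => (h (t - 1)).trans ?_,
      fun t ht1 ht2 => (h (t - 1)).trans ?_⟩
    · split_ifs <;> omega
    · have h1 := hgpos (t - 1) (by omega)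
      have h2 := h (t - 1)
      split_ifs at h2 ⊢ <;> omega
  · rintro ⟨h1, h2, h3⟩ m
    have hlen : μ.length = b + 2 := by
      by_contra hne
      have h4 := h3 (b + 2) (by omega) (by omega)
      have h5 := hgpos (b + 2) (by omega)
      simp only [show b + 2 - 1 = b + 1 by omega] at h4
      omega
    obtain rfl | hm := eq_or_ne m 0
    · simpa using h1
    · rw [if_neg (by omega)]
      split_ifs with h4 h5
      · exact h2 (m + 1) (by omega) (by omega)
      · omega
      · exact h3 (m + 1) (by omega) (by omega)
      · exact hgzero m (by omega)
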